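/- Let n ≥ 1, T > 0, q₀ ∈ ℝ, and let Q : [0, T] → ℝ be differentiable with Q(0) = q₀, Q(T) = 0, and derivative v periodic with period T/n on [0, (n−1)·T/n]. Define Q̃(t) = Q(t) − q₀·(1 − t/T). Then Q̃ is periodic with period T/n (i.e., Q̃(t + T/n) = Q̃(t) for all t ∈ [0, (n−1)·T/n]) and Q̃(k·T/n) = 0 for k = 0, 1, …, n. -/

import Mathlib

theorem periodic_strategy_decomposition (n : ℕ) (hn : 1 ≤ n) (T : ℝ) (hT : 0 < T)
    (q₀ : ℝ) (Q : ℝ → ℝ) (hQdiff : Differentiable ℝ Q)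
    (hQ0 : Q 0 = q₀) (hQT : Q T = 0)
    (hper : ∀ t : ℝ, 0 ≤ t → t ≤ ((n : ℝ) - 1) * T / n →
      deriv Q (t + T / n) = deriv Q t)
    (Qtilde : ℝ → ℝ) (hQt : ∀ t, Qtilde t = Q t - q₀ * (1 - t / T)) :
    (∀ t : ℝ, 0 ≤ t → t ≤ ((n : ℝ) - 1) * T / n → Qtilde (t + T / n) = Qtilde t) ∧
    (∀ k : ℕ, k ≤ n → Qtilde ((k : ℝ) * T / n) = 0) := by
  have hn0 : (0 : ℝ) < n := by exact_mod_cast hn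
  have hD : ∀ t ∈ Set.Icc (0 : ℝ) (((n : ℝ) - 1) * T / n),
      Q (t + T / n) - Q t = Q (0 + T / n) - Q 0 := by
    refine constant_of_has_deriv_right_zero (f := fun t => Q (t + T / n) - Q t) ?_ ?_
    · have := hQdiff.continuous
      fun_prop
    · intro x hx
      have h1 : HasDerivAt (fun t => Q (t + T / n)) (deriv Q (x + T / n)) x :=
        HasDerivAt.comp_add_const x (T / n) (hQdiff _).hasDerivAt
      have h2 := h1.sub (hQdiff x).hasDerivAt
      rw [hper x hx.1 hx.2.le, sub_self] at h2
      exact h2.hasDerivWithinAt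
  obtain ⟨c, hc⟩ : ∃ c, c = Q (0 + T / n) - Q 0 := ⟨_, rfl⟩
  rw [← hc] at hD
  have hk : ∀ k : ℕ, k ≤ n → Q ((k : ℝ) * T / n) = q₀ + k * c := by
    intro k
    induction k with
    | zero => intro _; simp [hQ0]
    | succ k ih =>
      intro h
      have h1 := ih (by omega)
      have hkn : (k : ℝ) + 1 ≤ n := by exact_mod_cast h
      have h2 := hD ((k : ℝ) * T / n) ⟨by positivity, by
        gcongr
        linarith⟩
      have e : ((k + 1 : ℕ) : ℝ) * T / n = (k : ℝ) * T / n + T / n := by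
        push_cast; ring
      rw [e]
      push_cast
      linarith
  have hcn : q₀ + n * c = 0 := by
    rw [← hk n le_rfl, mul_div_assoc, mul_div_cancel₀ _ hn0.ne', hQT]
  have hq : q₀ = -(n * c) := by linarith
  constructor
  · intro t h0 h1
    have h2 := hD t ⟨h0, h1⟩
    have h3 : Q (t + T / n) = Q t + c := by linarith
    rw [hQt, hQt, h3, hq]
    field_simp
    ring
  · intro k hkn
    rw [hQt, hk k hkn, hq]
    field_simp
    ring
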